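/- arXiv:1601.05918 — 2 statements merged into one kernel-verified Lean document; each statement's English description precedes it below -/
import Mathlib

section
/- There exist δ ∈ (0,1) and functions h₁(s₁,s₂), analytic on {(s₁,s₂) ∈ ℂ² : Re s₁ > 1−δ, Re s₂ > 1−δ}, and h₂(s₁,s₂,s₃), analytic on {(s₁,s₂,s₃) ∈ ℂ³ : Re s_i > 1−δ for i = 1,2,3}, such that for every (s₁,s₂,s₃) with Re s_i > 1−δ (i = 1,2,3), Re s₃ > 1, Re(s₂+s₃) > 2 and Re(s₁+s₂+s₃) > 3, one has ζ₃(s₁,s₂,s₃) = ζ(s₁+s₂+s₃−2)/((s₃−1)(s₂+s₃−2)) + h₁(s₁,s₂)/(s₃−1) + h₂(s₁,s₂,s₃). -/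
/-- The Euler–Zagier triple zeta-function
`ζ₃(s₁,s₂,s₃) = ∑_{0 < l < m < n} l^{-s₁} m^{-s₂} n^{-s₃}`. -/
noncomputable def zeta3 (s₁ s₂ s₃ : ℂ) : ℂ :=
  ∑' p : ℕ+ × ℕ+ × ℕ+,
    ((p.1 : ℕ) : ℂ) ^ (-s₁) * ((((p.1 : ℕ) + (p.2.1 : ℕ)) : ℂ) ^ (-s₂)) *
      ((((p.1 : ℕ) + (p.2.1 : ℕ) + (p.2.2 : ℕ)) : ℂ) ^ (-s₃))


section Helpers
open MeasureTheory Set Complex Metric Topology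

/-- The parameter interval. -/
abbrev TT : Type := ↥(Icc (0:ℝ) (2 * Real.pi))

noncomputable instance instTT : MeasureSpace TT := Measure.Subtype.measureSpace

/-- One-dimensional Cauchy formula on the compact interval. -/
lemma cauchy_one (c w : ℂ) (r : ℝ) (g : ℂ → ℂ) (hw : w ∈ ball c r)
    (hg : ∀ z ∈ closedBall c r, DifferentiableAt ℂ g z) :
    g w = ∫ t : TT, ((2 * Real.pi * I : ℂ)⁻¹ * (circleMap 0 r t * I)) *
      (circleMap c r t - w)⁻¹ * g (circleMap c r t) := by
  have h := two_pi_I_inv_smul_circleIntegral_sub_inv_smul_of_differentiable_on_off_countable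
    countable_empty hw (fun z hz => (hg z hz).continuousAt.continuousWithinAt)
    (fun z hz => hg z (ball_subset_closedBall hz.1))
  rw [← h, circleIntegral, intervalIntegral.integral_of_le (by positivity),
    ← integral_Icc_eq_integral_Ioc, ← integral_subtype_comap measurableSet_Icc, ← integral_smul]
  change _ = ∫ t : TT, _ ∂(Measure.comap Subtype.val volume)
  refine integral_congr_ae (Filter.Eventually.of_forall fun t => ?_)
  simp only [deriv_circleMap, smul_eq_mul]
  ring

lemma kernel_analytic {K : Type*} [TopologicalSpace K] [CompactSpace K] (γ : C(K, ℂ)) (w : ℂ)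
    (h : ∀ t, γ t ≠ w) : AnalyticAt ℂ (fun z : ℂ => Ring.inverse (γ - algebraMap ℂ C(K, ℂ) z)) w := by
  have hu : IsUnit (γ - algebraMap ℂ C(K, ℂ) w) := by
    rw [ContinuousMap.isUnit_iff_forall_ne_zero]
    intro t
    simpa [sub_eq_zero] using h t
  have h1 : AnalyticAt ℂ (Ring.inverse : C(K, ℂ) → C(K, ℂ)) (γ - algebraMap ℂ C(K, ℂ) w) := by
    obtain ⟨u, hu⟩ := hu
    rw [← hu]
    exact analyticAt_inverse u
  have h2 : AnalyticAt ℂ (fun z : ℂ => γ - algebraMap ℂ C(K, ℂ) z) w := by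
    simp_rw [Algebra.algebraMap_eq_smul_one]
    fun_prop
  exact AnalyticAt.fun_comp (f := fun z : ℂ => γ - algebraMap ℂ C(K, ℂ) z) h1 h2

lemma kernel_apply {K : Type*} [TopologicalSpace K] [CompactSpace K] (γ : C(K, ℂ)) (w : ℂ)
    (h : ∀ t, γ t ≠ w) (t : K) :
    (Ring.inverse (γ - algebraMap ℂ C(K, ℂ) w)) t = (γ t - w)⁻¹ := by
  have hu : IsUnit (γ - algebraMap ℂ C(K, ℂ) w) := by
    rw [ContinuousMap.isUnit_iff_forall_ne_zero]
    intro t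
    simpa [sub_eq_zero] using h t
  have := congrArg (fun φ : C(K, ℂ) => φ t) (Ring.inverse_mul_cancel _ hu)
  simp at this
  exact eq_inv_of_mul_eq_one_left this

lemma exists_clm {K : Type*} [TopologicalSpace K] [CompactSpace K] [MeasurableSpace K]
    [BorelSpace K] (μ : Measure K) [IsFiniteMeasure μ] (g : C(K, ℂ)) :
    ∃ Φ : C(K, ℂ) →L[ℂ] ℂ, ∀ k, Φ k = ∫ t, k t * g t ∂μ := by
  have hi : ∀ k : C(K, ℂ), Integrable (fun t => k t) μ := fun k =>
    (BoundedContinuousFunction.mkOfCompact k).integrable μ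
  refine ⟨LinearMap.mkContinuous
    { toFun := fun k => ∫ t, k t * g t ∂μ
      map_add' := ?_
      map_smul' := ?_ } (‖g‖ * μ.real univ) ?_, fun k => rfl⟩
  · intro a b
    have h1 := hi (a * g)
    have h2 := hi (b * g)
    simp only [ContinuousMap.add_apply, add_mul]
    exact integral_add h1 h2
  · intro c a
    simp only [ContinuousMap.smul_apply, smul_eq_mul, mul_assoc, RingHom.id_apply]
    exact integral_const_mul _ _
  · intro k
    refine (norm_integral_le_of_norm_le_const (C := ‖k‖ * ‖g‖)
      (Filter.Eventually.of_forall fun t => ?_)).trans (le_of_eq (by ring))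
    rw [norm_mul]
    gcongr
    · exact k.norm_coe_le_norm t
    · exact g.norm_coe_le_norm t

instance : IsFiniteMeasure (volume : Measure TT) := by
  constructor
  rw [Measure.Subtype.volume_univ measurableSet_Icc.nullMeasurableSet, Real.volume_Icc]
  exact ENNReal.ofReal_lt_top

abbrev KK : Type := TT × TT × TT

theorem osgood3 {U : Set (ℂ × ℂ × ℂ)} (hU : IsOpen U) (f : ℂ × ℂ × ℂ → ℂ)
    (hc : ContinuousOn f U)
    (h1 : ∀ p ∈ U, DifferentiableAt ℂ (fun z => f (z, p.2.1, p.2.2)) p.1)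
    (h2 : ∀ p ∈ U, DifferentiableAt ℂ (fun z => f (p.1, z, p.2.2)) p.2.1)
    (h3 : ∀ p ∈ U, DifferentiableAt ℂ (fun z => f (p.1, p.2.1, z)) p.2.2) :
    AnalyticOnNhd ℂ f U := by
  rintro ⟨a, b, c⟩ hp
  obtain ⟨r, hr, hrU⟩ := nhds_basis_closedBall.mem_iff.1 (hU.mem_nhds hp)
  have hsub : ∀ x ∈ closedBall a r, ∀ y ∈ closedBall b r, ∀ z ∈ closedBall c r, (x, y, z) ∈ U := by
    intro x hx y hy z hz
    apply hrU
    rw [← closedBall_prod_same, ← closedBall_prod_same]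
    exact ⟨hx, hy, hz⟩
  have hci : ∀ (c : ℂ) (t : ℝ), circleMap c r t ∈ closedBall c r :=
    fun c t => circleMap_mem_closedBall c hr.le t
  let W : ℝ → ℂ := fun t => (2 * Real.pi * I : ℂ)⁻¹ * (circleMap 0 r t * I)
  have hW : Continuous W := by fun_prop
  let γ1 : C(KK, ℂ) := ⟨fun t => circleMap a r t.1, by fun_prop⟩
  let γ2 : C(KK, ℂ) := ⟨fun t => circleMap b r t.2.1, by fun_prop⟩
  let γ3 : C(KK, ℂ) := ⟨fun t => circleMap c r t.2.2, by fun_prop⟩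
  have hgc : Continuous (fun t : KK => f (γ1 t, γ2 t, γ3 t)) := by
    refine hc.comp_continuous (by fun_prop) fun t => ?_
    exact hsub _ (hci _ _) _ (hci _ _) _ (hci _ _)
  let g : C(KK, ℂ) := ⟨fun t => W t.1 * W t.2.1 * W t.2.2 * f (γ1 t, γ2 t, γ3 t),
    (((hW.comp (by fun_prop)).mul (hW.comp (by fun_prop))).mul (hW.comp (by fun_prop))).mul hgc⟩
  obtain ⟨Φ, hΦ⟩ := exists_clm (volume : Measure KK) g
  let k : C(KK, ℂ) → ℂ → C(KK, ℂ) := fun γ z => Ring.inverse (γ - algebraMap ℂ C(KK, ℂ) z)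
  have hne : ∀ (c w : ℂ), w ∈ ball c r → ∀ t : ℝ, circleMap c r t ≠ w :=
    fun c w hw t => circleMap_ne_mem_ball hw t
  have key : ∀ q ∈ ball (a, b, c) r, Φ (k γ1 q.1 * k γ2 q.2.1 * k γ3 q.2.2) = f q := by
    rintro ⟨x, y, z⟩ hq
    rw [← ball_prod_same, ← ball_prod_same] at hq
    obtain ⟨hx, hy, hz⟩ := hq
    simp only at hx hy hz
    have hx' := ball_subset_closedBall hx
    have hy' := ball_subset_closedBall hy
    have hz' := ball_subset_closedBall hz
    have e1 := cauchy_one a x r (fun x => f (x, y, z)) hx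
      (fun w hw => h1 (w, y, z) (hsub _ hw _ hy' _ hz'))
    have e2 : ∀ t : ℝ, f (circleMap a r t, y, z) = _ := fun t =>
      cauchy_one b y r (fun y => f (circleMap a r t, y, z)) hy
      (fun w hw => h2 (circleMap a r t, w, z) (hsub _ (hci _ _) _ hw _ hz'))
    have e3 : ∀ t u : ℝ, f (circleMap a r t, circleMap b r u, z) = _ := fun t u =>
      cauchy_one c z r (fun z => f (circleMap a r t, circleMap b r u, z)) hz
      (fun w hw => h3 (circleMap a r t, circleMap b r u, w) (hsub _ (hci _ _) _ (hci _ _) _ hw))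
    have hk1 := kernel_apply γ1 x (fun t => hne _ _ hx _)
    have hk2 := kernel_apply γ2 y (fun t => hne _ _ hy _)
    have hk3 := kernel_apply γ3 z (fun t => hne _ _ hz _)
    let P : C(KK, ℂ) := k γ1 x * k γ2 y * k γ3 z * g
    have hP : ∀ t, P t = (circleMap a r t.1 - x)⁻¹ * (circleMap b r t.2.1 - y)⁻¹ *
        (circleMap c r t.2.2 - z)⁻¹ * (W t.1 * W t.2.1 * W t.2.2 *
        f (circleMap a r t.1, circleMap b r t.2.1, circleMap c r t.2.2)) := by
      intro t
      simp only [P, k, ContinuousMap.mul_apply, hk1, hk2, hk3]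
      rfl
    have hPi : Integrable (fun t => P t) (volume : Measure KK) :=
      (BoundedContinuousFunction.mkOfCompact P).integrable _
    rw [hΦ]
    change ∫ t, P t = _
    rw [Measure.volume_eq_prod, integral_prod _ hPi]
    rw [e1]
    refine integral_congr_ae (Filter.Eventually.of_forall fun t => ?_)
    simp only
    rw [e2 t]
    have hPt : Integrable (fun s => P (t, s)) (volume : Measure (TT × TT)) :=
      (BoundedContinuousFunction.mkOfCompact
        (⟨fun s => P (t, s), by fun_prop⟩ : C(TT × TT, ℂ))).integrable _
    rw [Measure.volume_eq_prod, integral_prod _ hPt, ← integral_const_mul]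
    refine integral_congr_ae (Filter.Eventually.of_forall fun u => ?_)
    simp only
    rw [e3 t u, ← integral_const_mul, ← integral_const_mul]
    refine integral_congr_ae (Filter.Eventually.of_forall fun v => ?_)
    simp only [hP, W]
    ring
  have hev : (fun q : ℂ × ℂ × ℂ => Φ (k γ1 q.1 * k γ2 q.2.1 * k γ3 q.2.2)) =ᶠ[𝓝 (a, b, c)] f := by
    filter_upwards [ball_mem_nhds _ hr] with q hq using key q hq
  refine AnalyticAt.congr ?_ hev
  have A1 : AnalyticAt ℂ (fun q : ℂ × ℂ × ℂ => k γ1 q.1) (a, b, c) :=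
    (kernel_analytic γ1 a (fun t => hne _ _ (mem_ball_self hr) _)).fun_comp_of_eq analyticAt_fst rfl
  have A2 : AnalyticAt ℂ (fun q : ℂ × ℂ × ℂ => k γ2 q.2.1) (a, b, c) :=
    (kernel_analytic γ2 b (fun t => hne _ _ (mem_ball_self hr) _)).fun_comp_of_eq
      (analyticAt_fst.comp analyticAt_snd) rfl
  have A3 : AnalyticAt ℂ (fun q : ℂ × ℂ × ℂ => k γ3 q.2.2) (a, b, c) :=
    (kernel_analytic γ3 c (fun t => hne _ _ (mem_ball_self hr) _)).fun_comp_of_eq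
      (analyticAt_snd.comp analyticAt_snd) rfl
  exact (Φ.analyticAt _).comp ((A1.mul A2).mul A3)

theorem analytic_tsum3 {ι : Type*} {U : Set (ℂ × ℂ × ℂ)} (hU : IsOpen U)
    {F : ι → ℂ × ℂ × ℂ → ℂ} (hF : ∀ i, AnalyticOnNhd ℂ (F i) U) {u : ι → ℝ} (hu : Summable u)
    (hb : ∀ i, ∀ p ∈ U, ‖F i p‖ ≤ u i) : AnalyticOnNhd ℂ (fun p => ∑' i, F i p) U := by
  have slice : ∀ (L : ℂ → ℂ × ℂ × ℂ) (z : ℂ), Differentiable ℂ L → L z ∈ U →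
      DifferentiableAt ℂ (fun z => ∑' i, F i (L z)) z := by
    intro L z hL hz
    have hV : IsOpen (L ⁻¹' U) := hU.preimage hL.continuous
    refine (differentiableOn_tsum_of_summable_norm hu (fun i w hw => ?_) hV
      (fun i w hw => hb i _ hw)).differentiableAt (hV.mem_nhds hz)
    exact ((hF i _ hw).differentiableAt.comp w (hL w)).differentiableWithinAt
  refine osgood3 hU _ (continuousOn_tsum (fun i => (hF i).continuousOn) hu hb) ?_ ?_ ?_
  · exact fun p hp => slice (fun z => (z, p.2.1, p.2.2)) p.1 (by fun_prop) hp
  · exact fun p hp => slice (fun z => (p.1, z, p.2.2)) p.2.1 (by fun_prop) hp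
  · exact fun p hp => slice (fun z => (p.1, p.2.1, z)) p.2.2 (by fun_prop) hp

theorem analytic_dslope3 {U : Set (ℂ × ℂ × ℂ)} (hU : IsOpen U)
    (hU1 : ∀ p ∈ U, (p.1, p.2.1, (1:ℂ)) ∈ U) {H : ℂ × ℂ × ℂ → ℂ} (hH : AnalyticOnNhd ℂ H U) :
    AnalyticOnNhd ℂ (fun p => dslope (fun z => H (p.1, p.2.1, z)) 1 p.2.2) U := by
  have hne : ∀ p : ℂ × ℂ × ℂ, p.2.2 ≠ 1 → dslope (fun z => H (p.1, p.2.1, z)) 1 p.2.2 =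
      (p.2.2 - 1)⁻¹ * (H p - H (p.1, p.2.1, 1)) := by
    intro p hp
    rw [dslope_of_ne _ hp, slope_def_module]
    rfl
  have heq : ∀ p ∈ U, p.2.2 = 1 → dslope (fun z => H (p.1, p.2.1, z)) 1 p.2.2 =
      fderiv ℂ H p (0, 0, 1) := by
    rintro ⟨x, y, z⟩ hp rfl
    simp only [dslope_same]
    have h := (hH _ hp).differentiableAt.hasFDerivAt
    have hl : HasDerivAt (fun z : ℂ => (x, y, z)) ((0:ℂ), (0:ℂ), (1:ℂ)) 1 :=
      (hasDerivAt_const _ _).prodMk ((hasDerivAt_const _ _).prodMk (hasDerivAt_id _))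
    exact (h.comp_hasDerivAt (1:ℂ) hl).deriv
  have hfd : AnalyticOnNhd ℂ (fun p => fderiv ℂ H p (0, 0, 1)) U := fun p hp =>
    ((ContinuousLinearMap.apply ℂ ℂ ((0:ℂ), (0:ℂ), (1:ℂ))).analyticAt _).comp (hH p hp).fderiv
  -- analyticity away from the hyperplane
  have hoff : ∀ p ∈ U, p.2.2 ≠ 1 →
      AnalyticAt ℂ (fun p : ℂ × ℂ × ℂ => dslope (fun z => H (p.1, p.2.1, z)) 1 p.2.2) p := by
    intro p hp hp1
    have hopen : ∀ᶠ q : ℂ × ℂ × ℂ in 𝓝 p, q.2.2 ≠ 1 :=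
      (isOpen_ne.preimage (continuous_snd.comp continuous_snd)).mem_nhds hp1
    have hA : AnalyticAt ℂ (fun p : ℂ × ℂ × ℂ => (p.2.2 - 1)⁻¹ * (H p - H (p.1, p.2.1, 1))) p := by
      have a1 : AnalyticAt ℂ (fun p : ℂ × ℂ × ℂ => p.1) p := analyticAt_fst
      have a2 : AnalyticAt ℂ (fun p : ℂ × ℂ × ℂ => p.2.1) p := analyticAt_fst.comp analyticAt_snd
      have a3 : AnalyticAt ℂ (fun p : ℂ × ℂ × ℂ => p.2.2) p := analyticAt_snd.comp analyticAt_snd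
      have a4 : AnalyticAt ℂ (fun p : ℂ × ℂ × ℂ => H (p.1, p.2.1, 1)) p :=
        (hH _ (hU1 p hp)).fun_comp_of_eq (a1.prod (a2.prod analyticAt_const)) rfl
      exact ((a3.sub analyticAt_const).inv (sub_ne_zero.2 hp1)).mul ((hH p hp).sub a4)
    exact hA.congr (hopen.mono fun q hq => (hne q hq).symm)
  refine osgood3 hU _ ?_ ?_ ?_ ?_
  · intro p hp
    apply ContinuousAt.continuousWithinAt
    by_cases hp1 : p.2.2 = 1
    · rw [ContinuousAt, heq p hp hp1, Metric.tendsto_nhds]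
      intro ε hε
      have hs := (hH p hp).hasStrictFDerivAt.isLittleO.def (half_pos hε)
      have hp' : (p.1, p.2.1, (1:ℂ)) = p := by rw [← hp1]
      have ht : Filter.Tendsto (fun q : ℂ × ℂ × ℂ => (q, (q.1, q.2.1, (1:ℂ)))) (𝓝 p) (𝓝 (p, p)) := by
        have : Continuous (fun q : ℂ × ℂ × ℂ => (q, (q.1, q.2.1, (1:ℂ)))) := by fun_prop
        have := this.tendsto p
        rwa [hp'] at this
      have h2 := Metric.tendsto_nhds.1 (hfd p hp).continuousAt ε hε
      filter_upwards [ht.eventually hs, h2, hU.mem_nhds hp] with q hq1 hq2 hqU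
      by_cases hq : q.2.2 = 1
      · rw [heq q hqU hq]; exact hq2
      · rw [hne q hq]
        have hd : q - (q.1, q.2.1, (1:ℂ)) = (q.2.2 - 1) • ((0:ℂ), (0:ℂ), (1:ℂ)) := by
          ext <;> simp
        have hn : ‖q.2.2 - 1‖ ≠ 0 := norm_ne_zero_iff.2 (sub_ne_zero.2 hq)
        simp only [hd, map_smul, norm_smul, smul_eq_mul] at hq1
        have h01 : ‖((0:ℂ), (0:ℂ), (1:ℂ))‖ = 1 := by simp [Prod.norm_def]
        rw [h01, mul_one] at hq1
        rw [dist_eq_norm]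
        have : (q.2.2 - 1)⁻¹ * (H q - H (q.1, q.2.1, 1)) - fderiv ℂ H p (0, 0, 1) =
            (q.2.2 - 1)⁻¹ * (H q - H (q.1, q.2.1, 1) - (q.2.2 - 1) * fderiv ℂ H p (0, 0, 1)) := by
          field_simp [sub_ne_zero.2 hq]
        rw [this, norm_mul, norm_inv]
        calc _ ≤ ‖q.2.2 - 1‖⁻¹ * (ε / 2 * ‖q.2.2 - 1‖) := by gcongr
          _ = ε / 2 := by field_simp
          _ < ε := half_lt_self hε
    · exact (hoff p hp hp1).continuousAt
  · intro p hp
    by_cases hp1 : p.2.2 = 1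
    · have hl : Differentiable ℂ (fun z : ℂ => (z, p.2.1, p.2.2)) := by fun_prop
      have h := (hfd p hp).differentiableAt.comp (f := fun z : ℂ => (z, p.2.1, p.2.2)) p.1 (hl p.1)
      refine h.congr_of_eventuallyEq ?_
      filter_upwards [(hU.preimage hl.continuous).mem_nhds hp] with z hz using heq _ hz hp1
    · exact (hoff p hp hp1).differentiableAt.comp (f := fun z : ℂ => (z, p.2.1, p.2.2)) p.1
        (by fun_prop)
  · intro p hp
    by_cases hp1 : p.2.2 = 1
    · have hl : Differentiable ℂ (fun z : ℂ => (p.1, z, p.2.2)) := by fun_prop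
      have h := (hfd p hp).differentiableAt.comp (f := fun z : ℂ => (p.1, z, p.2.2)) p.2.1 (hl _)
      refine h.congr_of_eventuallyEq ?_
      filter_upwards [(hU.preimage hl.continuous).mem_nhds hp] with z hz using heq _ hz hp1
    · exact (hoff p hp hp1).differentiableAt.comp (f := fun z : ℂ => (p.1, z, p.2.2)) p.2.1
        (by fun_prop)
  · intro p hp
    have hl : Differentiable ℂ (fun z : ℂ => (p.1, p.2.1, z)) := by fun_prop
    have hV := hU.preimage hl.continuous
    refine ((differentiableOn_dslope (hV.mem_nhds (hU1 p hp))).2 ?_).differentiableAt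
      (hV.mem_nhds hp)
    intro z hz
    exact ((hH _ hz).differentiableAt.comp z (hl z)).differentiableWithinAt

/-- The local error term `(x+1)^{-s} - ∫_x^{x+1} t^{-s} dt`. -/
noncomputable def ee (x : ℝ) (s : ℂ) : ℂ :=
  ((x + 1 : ℝ) : ℂ) ^ (-s) + dslope (fun s : ℂ => ((x + 1 : ℝ) : ℂ) ^ (1 - s) - (x : ℂ) ^ (1 - s)) 1 s

lemma ee_of_ne (x : ℝ) (s : ℂ) (hs : s ≠ 1) :
    ee x s = ((x + 1 : ℝ) : ℂ) ^ (-s) +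
      (((x + 1 : ℝ) : ℂ) ^ (1 - s) - (x : ℂ) ^ (1 - s)) / (s - 1) := by
  rw [ee, dslope_of_ne _ hs, slope_def_field]
  simp

lemma ee_differentiable (x : ℝ) (hx : 0 < x) : Differentiable ℂ (ee x) := by
  have h1 : ((x + 1 : ℝ) : ℂ) ≠ 0 := by exact_mod_cast (by positivity : x + 1 ≠ 0)
  have h2 : (x : ℂ) ≠ 0 := by exact_mod_cast hx.ne'
  have hA : ∀ g : ℂ → ℂ, Differentiable ℂ g → Differentiable ℂ (fun s => ((x + 1 : ℝ) : ℂ) ^ (g s)) :=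
    fun g hg s => (hg s).const_cpow (Or.inl h1)
  have hB : Differentiable ℂ (fun s : ℂ => (x : ℂ) ^ (1 - s)) :=
    fun s => DifferentiableAt.const_cpow (by fun_prop) (Or.inl h2)
  have hd : Differentiable ℂ
      (dslope (fun s : ℂ => ((x + 1 : ℝ) : ℂ) ^ (1 - s) - (x : ℂ) ^ (1 - s)) 1) := by
    rw [← differentiableOn_univ]
    refine (differentiableOn_dslope Filter.univ_mem).2 ?_
    exact ((hA _ (by fun_prop)).sub hB).differentiableOn
  exact (hA _ (by fun_prop)).add hd

lemma ee_bound_ne (x : ℝ) (hx : 0 < x) (s : ℂ) (hs : s ≠ 1) (h0 : 0 < s.re) :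
    ‖ee x s‖ ≤ ‖s‖ * x ^ (-s.re - 1) := by
  have hint : ∫ t in x..(x + 1), ((t : ℂ) ^ (-s)) =
      -((((x + 1 : ℝ) : ℂ) ^ (1 - s) - (x : ℂ) ^ (1 - s)) / (s - 1)) := by
    rw [integral_cpow]
    · rw [show -s + 1 = 1 - s by ring, ← neg_sub s 1, div_neg]
    · right
      refine ⟨fun h => hs (by simpa using h), ?_⟩
      rw [uIcc_of_le (by linarith)]
      intro h
      exact absurd h.1 (by linarith)
  have hii : IntervalIntegrable (fun t : ℝ => (t : ℂ) ^ (-s)) volume x (x + 1) := by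
    apply intervalIntegral.intervalIntegrable_cpow
    right
    rw [uIcc_of_le (by linarith)]
    intro h
    exact absurd h.1 (by linarith)
  have heq : ee x s = ∫ t in x..(x + 1), (((x + 1 : ℝ) : ℂ) ^ (-s) - (t : ℂ) ^ (-s)) := by
    rw [intervalIntegral.integral_sub (by simp) hii, hint, ee_of_ne x s hs]
    simp
  rw [heq]
  have := intervalIntegral.norm_integral_le_of_norm_le_const (a := x) (b := x + 1)
    (f := fun t : ℝ => (((x + 1 : ℝ) : ℂ) ^ (-s) - (t : ℂ) ^ (-s))) (C := ‖s‖ * x ^ (-s.re - 1)) ?_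
  · simpa using this
  intro t ht
  rw [uIoc_of_le (by linarith)] at ht
  have hder : ∀ y ∈ Icc x (x + 1), HasDerivWithinAt (fun t : ℝ => (t : ℂ) ^ (-s))
      (-s * (y : ℂ) ^ (-s - 1)) (Icc x (x + 1)) y := by
    intro y hy
    have hy0 : y ≠ 0 := (hx.trans_le hy.1).ne'
    have hs0 : -s ≠ 0 := by
      intro h
      rw [neg_eq_zero] at h
      simp [h] at h0
    exact (hasDerivAt_ofReal_cpow_const hy0 hs0).hasDerivWithinAt
  have hmv := (convex_Icc x (x + 1)).norm_image_sub_le_of_norm_hasDerivWithin_le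
    (C := ‖s‖ * x ^ (-s.re - 1)) hder ?_ (⟨ht.1.le, ht.2⟩ : t ∈ Icc x (x + 1))
    (right_mem_Icc.2 (by linarith))
  · refine hmv.trans ?_
    rw [Real.norm_eq_abs, abs_of_nonneg (by linarith [ht.2])]
    have : x + 1 - t ≤ 1 := by linarith [ht.1]
    exact mul_le_of_le_one_right (by positivity) this
  · intro y hy
    have hy0 : 0 < y := hx.trans_le hy.1
    rw [norm_mul, norm_neg, norm_cpow_eq_rpow_re_of_pos hy0]
    gcongr
    simp only [sub_re, neg_re, one_re]
    exact Real.rpow_le_rpow_of_nonpos hx hy.1 (by linarith)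

lemma ee_bound (x : ℝ) (hx : 0 < x) (s : ℂ) (h0 : 0 < s.re) :
    ‖ee x s‖ ≤ ‖s‖ * x ^ (-s.re - 1) := by
  by_cases hs : s = 1
  · subst hs
    have hc1 : Filter.Tendsto (fun s => ‖ee x s‖) (𝓝[≠] 1) (𝓝 ‖ee x 1‖) :=
      ((ee_differentiable x hx).continuous.norm.tendsto 1).mono_left nhdsWithin_le_nhds
    have hc2 : Filter.Tendsto (fun s : ℂ => ‖s‖ * x ^ (-s.re - 1)) (𝓝[≠] 1)
        (𝓝 (‖(1:ℂ)‖ * x ^ (-(1:ℂ).re - 1))) := by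
      have : Continuous (fun s : ℂ => ‖s‖ * x ^ (-s.re - 1)) :=
        continuous_norm.mul (Continuous.rpow continuous_const
          (by fun_prop) (fun _ => Or.inl hx.ne'))
      exact (this.tendsto 1).mono_left nhdsWithin_le_nhds
    refine le_of_tendsto_of_tendsto hc1 hc2 ?_
    have hpos : ∀ᶠ s : ℂ in 𝓝[≠] 1, 0 < s.re :=
      nhdsWithin_le_nhds ((isOpen_lt continuous_const continuous_re).mem_nhds h0)
    filter_upwards [hpos, self_mem_nhdsWithin] with s h1 h2
    exact ee_bound_ne x hx s h2 h1
  · exact ee_bound_ne x hx s hs h0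

lemma summable_pnat (a : ℝ) (ha : 1 < a) : Summable (fun n : ℕ+ => (n : ℝ) ^ (-a)) :=
  (Real.summable_nat_rpow.2 (by linarith : -a < -1)).comp_injective PNat.coe_injective

lemma pnat_one_le (n : ℕ+) : (1:ℝ) ≤ (n : ℝ) := by exact_mod_cast n.pos

lemma rpow_neg_anti {x y a : ℝ} (hx : 1 ≤ x) (hxy : x ≤ y) (ha : 0 ≤ a) : y ^ (-a) ≤ x ^ (-a) :=
  Real.rpow_le_rpow_of_nonpos (by linarith) hxy (by linarith)

lemma summable2 (a b : ℝ) (hb : 1 < b) (hab : 2 < a + b) :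
    Summable (fun q : ℕ+ × ℕ+ => (q.1 : ℝ) ^ (-a) * ((q.1 : ℝ) + (q.2 : ℝ)) ^ (-b)) := by
  obtain ⟨ε, h0, h1, h2⟩ : ∃ ε : ℝ, 0 < ε ∧ ε ≤ b - 1 ∧ ε < a + b - 2 := by
    obtain ⟨ε, h0, h1⟩ := exists_between (lt_min (sub_pos.2 hb) (sub_pos.2 hab))
    exact ⟨ε, h0, (h1.trans_le (min_le_left _ _)).le, h1.trans_le (min_le_right _ _)⟩
  have hs := (summable_pnat (a + b - 1 - ε) (by linarith)).mul_of_nonneg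
    (summable_pnat (1 + ε) (by linarith)) (fun _ => by positivity) (fun _ => by positivity)
  refine hs.of_nonneg_of_le (fun _ => by positivity) ?_
  rintro ⟨l, j⟩
  have hl := pnat_one_le l
  have hj := pnat_one_le j
  simp only
  have e1 : ((l:ℝ) + j) ^ (-b) = ((l:ℝ) + j) ^ (-(b - 1 - ε)) * ((l:ℝ) + j) ^ (-(1 + ε)) := by
    rw [← Real.rpow_add (by positivity)]; congr 1; ring
  have e2 : (l:ℝ) ^ (-(a + b - 1 - ε)) = (l:ℝ) ^ (-a) * (l:ℝ) ^ (-(b - 1 - ε)) := by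
    rw [← Real.rpow_add (by positivity)]; congr 1; ring
  rw [e1, e2, mul_assoc]
  have i1 := rpow_neg_anti (x := (l:ℝ)) (y := (l:ℝ) + j) (a := b - 1 - ε) hl (by linarith) (by linarith)
  have i2 := rpow_neg_anti (x := (j:ℝ)) (y := (l:ℝ) + j) (a := 1 + ε) hj (by linarith) (by linarith)
  gcongr

lemma summable3 (a b c : ℝ) (hc : 1 < c) (hb : 2 < b + c) (hab : 3 < a + b + c) :
    Summable (fun q : (ℕ+ × ℕ+) × ℕ+ => (q.1.1 : ℝ) ^ (-a) * ((q.1.1 : ℝ) + (q.1.2 : ℝ)) ^ (-b) *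
      ((q.1.1 : ℝ) + (q.1.2 : ℝ) + (q.2 : ℝ)) ^ (-c)) := by
  obtain ⟨ε, h0, h1, h2, h3⟩ : ∃ ε : ℝ, 0 < ε ∧ ε ≤ c - 1 ∧ ε < b + c - 2 ∧ ε < a + b + c - 3 := by
    obtain ⟨ε, h0, h1⟩ := exists_between (lt_min (sub_pos.2 hc)
      (lt_min (sub_pos.2 hb) (sub_pos.2 hab)))
    exact ⟨ε, h0, (h1.trans_le (min_le_left _ _)).le,
      h1.trans_le ((min_le_right _ _).trans (min_le_left _ _)),
      h1.trans_le ((min_le_right _ _).trans (min_le_right _ _))⟩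
  have hs := (summable2 a (b + c - 1 - ε) (by linarith) (by linarith)).mul_of_nonneg
    (summable_pnat (1 + ε) (by linarith)) (fun _ => by positivity) (fun _ => by positivity)
  refine hs.of_nonneg_of_le (fun _ => by positivity) ?_
  rintro ⟨⟨l, j⟩, k⟩
  have hl := pnat_one_le l
  have hj := pnat_one_le j
  have hk := pnat_one_le k
  simp only
  have e1 : ((l:ℝ) + j + k) ^ (-c) =
      ((l:ℝ) + j + k) ^ (-(c - 1 - ε)) * ((l:ℝ) + j + k) ^ (-(1 + ε)) := by
    rw [← Real.rpow_add (by positivity)]; congr 1; ring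
  have e2 : ((l:ℝ) + j) ^ (-(b + c - 1 - ε)) = ((l:ℝ) + j) ^ (-b) * ((l:ℝ) + j) ^ (-(c - 1 - ε)) := by
    rw [← Real.rpow_add (by positivity)]; congr 1; ring
  rw [e1, e2, ← mul_assoc, ← mul_assoc]
  have i1 := rpow_neg_anti (x := (l:ℝ) + j) (y := (l:ℝ) + j + k) (a := c - 1 - ε)
    (by linarith) (by linarith) (by linarith)
  have i2 := rpow_neg_anti (x := (k:ℝ)) (y := (l:ℝ) + j + k) (a := 1 + ε)
    hk (by linarith) (by linarith)
  gcongr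

lemma tail_sum (m : ℕ+) (s : ℂ) (hs : 1 < s.re) :
    ∑' k : ℕ+, (((m : ℝ) + (k : ℝ) : ℝ) : ℂ) ^ (-s) =
      ∑' k : ℕ+, ee ((m : ℝ) + (k : ℝ) - 1) s + ((m : ℝ) : ℂ) ^ (1 - s) / (s - 1) := by
  have hm := pnat_one_le m
  have hs1 : s ≠ 1 := by rintro rfl; simp at hs
  have S1 : Summable (fun k : ℕ+ => (((m : ℝ) + (k : ℝ) : ℝ) : ℂ) ^ (-s)) := by
    refine Summable.of_norm_bounded (summable_pnat s.re hs) fun k => ?_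
    have hk := pnat_one_le k
    rw [norm_cpow_eq_rpow_re_of_pos (by linarith), neg_re]
    exact rpow_neg_anti hk (by linarith) (by linarith)
  have S2 : Summable (fun k : ℕ+ => ee ((m : ℝ) + (k : ℝ) - 1) s) := by
    refine Summable.of_norm_bounded ((summable_pnat (s.re + 1) (by linarith)).mul_left ‖s‖)
      fun k => ?_
    have hk := pnat_one_le k
    refine (ee_bound _ (by linarith) s (by linarith)).trans ?_
    gcongr
    rw [show -s.re - 1 = -(s.re + 1) by ring]
    exact rpow_neg_anti hk (by linarith) (by linarith)
  rw [← sub_eq_iff_eq_add', ← S1.tsum_sub S2]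
  let g : ℕ → ℂ := fun k => (((m : ℝ) + (k : ℝ) : ℝ) : ℂ) ^ (1 - s) / (s - 1)
  have hterm : ∀ k : ℕ, (((m : ℝ) + ((k.succPNat : ℕ+) : ℝ) : ℝ) : ℂ) ^ (-s) -
      ee ((m : ℝ) + ((k.succPNat : ℕ+) : ℝ) - 1) s = g k - g (k + 1) := by
    intro k
    have hk0 : (0:ℝ) ≤ k := Nat.cast_nonneg k
    have e : ((k.succPNat : ℕ+) : ℝ) = (k:ℝ) + 1 := by simp
    rw [e, show (m:ℝ) + ((k:ℝ) + 1) - 1 = m + k by ring, ee_of_ne _ _ hs1]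
    simp only [g]
    rw [show (m:ℝ) + ((k:ℝ) + 1) = m + k + 1 by ring,
      show (m:ℝ) + ((k + 1 : ℕ) : ℝ) = m + k + 1 by push_cast; ring]
    ring
  have S3 : Summable (fun k : ℕ => g k - g (k + 1)) := by
    have := (Equiv.pnatEquivNat.symm.summable_iff).2 (S1.sub S2)
    refine this.congr fun k => ?_
    exact hterm k
  have hg : Filter.Tendsto g Filter.atTop (𝓝 0) := by
    rw [tendsto_zero_iff_norm_tendsto_zero]
    have h1 : Filter.Tendsto (fun k : ℕ => ((m:ℝ) + k) ^ (-(s.re - 1)) / ‖s - 1‖)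
        Filter.atTop (𝓝 (0 / ‖s - 1‖)) :=
      ((tendsto_rpow_neg_atTop (by linarith)).comp
        (Filter.tendsto_atTop_add_const_left _ _ tendsto_natCast_atTop_atTop)).div_const _
    rw [zero_div] at h1
    refine h1.congr fun k => ?_
    have hk0 : (0:ℝ) ≤ k := Nat.cast_nonneg k
    simp only [g]
    rw [norm_div, norm_cpow_eq_rpow_re_of_pos (by linarith)]
    simp
  have hlim := S3.hasSum.tendsto_sum_nat
  simp only [Finset.sum_range_sub'] at hlim
  have h2 : Filter.Tendsto (fun n => g 0 - g n) Filter.atTop (𝓝 (g 0 - 0)) := hg.const_sub _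
  have := tendsto_nhds_unique hlim h2
  rw [← Equiv.pnatEquivNat.symm.tsum_eq]
  have h3 : ∑' k : ℕ, (g k - g (k + 1)) = g 0 := by rw [this, sub_zero]
  rw [show ((m : ℝ) : ℂ) ^ (1 - s) / (s - 1) = g 0 by simp [g], ← h3]
  exact tsum_congr fun k => hterm k

/-- The domain. -/
def DD : Set (ℂ × ℂ × ℂ) :=
  {p | 1 - (1/4 : ℝ) < p.1.re ∧ 1 - (1/4 : ℝ) < p.2.1.re ∧ 1 - (1/4 : ℝ) < p.2.2.re}

lemma isOpen_DD : IsOpen DD := by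
  have h1 : IsOpen {p : ℂ × ℂ × ℂ | 1 - (1/4 : ℝ) < p.1.re} :=
    isOpen_lt continuous_const (continuous_re.comp continuous_fst)
  have h2 : IsOpen {p : ℂ × ℂ × ℂ | 1 - (1/4 : ℝ) < p.2.1.re} :=
    isOpen_lt continuous_const (continuous_re.comp (continuous_fst.comp continuous_snd))
  have h3 : IsOpen {p : ℂ × ℂ × ℂ | 1 - (1/4 : ℝ) < p.2.2.re} :=
    isOpen_lt continuous_const (continuous_re.comp (continuous_snd.comp continuous_snd))
  exact h1.inter (h2.inter h3)

noncomputable def tA (q : (ℕ+ × ℕ+) × ℕ+) (p : ℂ × ℂ × ℂ) : ℂ :=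
  ((q.1.1 : ℝ) : ℂ) ^ (-p.1) * (((q.1.1 : ℝ) + (q.1.2 : ℝ) : ℝ) : ℂ) ^ (-p.2.1) *
    ee ((q.1.1 : ℝ) + (q.1.2 : ℝ) + (q.2 : ℝ) - 1) p.2.2

noncomputable def tG (q : ℕ+ × ℕ+) (p : ℂ × ℂ × ℂ) : ℂ :=
  ((q.1 : ℝ) : ℂ) ^ (-p.1) * ee ((q.1 : ℝ) + (q.2 : ℝ) - 1) (p.2.1 + p.2.2 - 1)

lemma comp1 {g : ℂ → ℂ} (hg : Differentiable ℂ g) {L : ℂ × ℂ × ℂ → ℂ} {p : ℂ × ℂ × ℂ}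
    (hL : AnalyticAt ℂ L p) : AnalyticAt ℂ (fun p => g (L p)) p :=
  (hg.analyticAt (L p)).fun_comp hL

lemma cpow_neg_diff (x : ℝ) (hx : 0 < x) : Differentiable ℂ (fun s : ℂ => (x : ℂ) ^ (-s)) :=
  fun s => DifferentiableAt.const_cpow (by fun_prop) (Or.inl (by exact_mod_cast hx.ne'))

lemma an1 (p : ℂ × ℂ × ℂ) : AnalyticAt ℂ (fun p : ℂ × ℂ × ℂ => p.1) p := analyticAt_fst
lemma an2 (p : ℂ × ℂ × ℂ) : AnalyticAt ℂ (fun p : ℂ × ℂ × ℂ => p.2.1) p :=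
  analyticAt_fst.comp analyticAt_snd
lemma an3 (p : ℂ × ℂ × ℂ) : AnalyticAt ℂ (fun p : ℂ × ℂ × ℂ => p.2.2) p :=
  analyticAt_snd.comp analyticAt_snd

lemma tA_analytic (q : (ℕ+ × ℕ+) × ℕ+) (p : ℂ × ℂ × ℂ) : AnalyticAt ℂ (tA q) p := by
  have h1 := pnat_one_le q.1.1
  have h2 := pnat_one_le q.1.2
  have h3 := pnat_one_le q.2
  exact ((comp1 (cpow_neg_diff _ (by linarith)) (an1 p)).mul
    (comp1 (cpow_neg_diff _ (by linarith)) (an2 p))).mul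
    (comp1 (ee_differentiable _ (by linarith)) (an3 p))

lemma tG_analytic (q : ℕ+ × ℕ+) (p : ℂ × ℂ × ℂ) : AnalyticAt ℂ (tG q) p := by
  have h1 := pnat_one_le q.1
  have h2 := pnat_one_le q.2
  exact (comp1 (cpow_neg_diff _ (by linarith)) (an1 p)).mul
    (comp1 (ee_differentiable _ (by linarith)) (((an2 p).add (an3 p)).sub analyticAt_const))

lemma cpow_bound (x a : ℝ) (hx : 1 ≤ x) (s : ℂ) (hs : a ≤ s.re) :
    ‖(x : ℂ) ^ (-s)‖ ≤ x ^ (-a) := by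
  rw [norm_cpow_eq_rpow_re_of_pos (by linarith), neg_re]
  exact Real.rpow_le_rpow_of_exponent_le hx (by linarith)

lemma ee_bound' (x a R : ℝ) (hx : 1 ≤ x) (s : ℂ) (ha : 0 < a) (hs : a ≤ s.re) (hR : ‖s‖ ≤ R) :
    ‖ee x s‖ ≤ R * x ^ (-(a + 1)) := by
  refine (ee_bound x (by linarith) s (by linarith)).trans ?_
  have : x ^ (-s.re - 1) ≤ x ^ (-(a + 1)) :=
    Real.rpow_le_rpow_of_exponent_le hx (by linarith)
  have h0 : 0 ≤ R := (norm_nonneg s).trans hR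
  gcongr

noncomputable def uA (q : (ℕ+ × ℕ+) × ℕ+) : ℝ :=
  (q.1.1 : ℝ) ^ (-(105/100 : ℝ)) * (q.1.2 : ℝ) ^ (-(105/100 : ℝ)) * (q.2 : ℝ) ^ (-(115/100 : ℝ))

noncomputable def uG (q : ℕ+ × ℕ+) : ℝ :=
  (q.1 : ℝ) ^ (-(105/100 : ℝ)) * (q.2 : ℝ) ^ (-(120/100 : ℝ))

lemma summable_uG : Summable uG :=
  (summable_pnat _ (by norm_num)).mul_of_nonneg (summable_pnat _ (by norm_num))
    (fun _ => by positivity) (fun _ => by positivity)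

lemma summable_uA : Summable uA :=
  ((summable_pnat _ (by norm_num)).mul_of_nonneg (summable_pnat _ (by norm_num))
    (fun _ => by positivity) (fun _ => by positivity)).mul_of_nonneg
    (summable_pnat _ (by norm_num)) (fun _ => by positivity) (fun _ => by positivity)

lemma tA_bound (R : ℝ) (q : (ℕ+ × ℕ+) × ℕ+) (p : ℂ × ℂ × ℂ) (hp : p ∈ DD) (hR : ‖p‖ ≤ R) :
    ‖tA q p‖ ≤ R * uA q := by
  obtain ⟨⟨l, j⟩, k⟩ := q
  obtain ⟨s1, s2, s3⟩ := p
  obtain ⟨g1, g2, g3⟩ := hp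
  simp only at g1 g2 g3
  have hl := pnat_one_le l
  have hj := pnat_one_le j
  have hk := pnat_one_le k
  have hR0 : 0 ≤ R := (norm_nonneg _).trans hR
  have hn : ‖s3‖ ≤ R := (norm_snd_le (s2, s3)).trans ((norm_snd_le (s1, s2, s3)).trans hR)
  set x : ℝ := (l:ℝ) + j + k - 1 with hxd
  have hx : 1 ≤ x := by linarith
  have b1 := cpow_bound l (3/4) hl s1 (by linarith)
  have b2 := (cpow_bound ((l:ℝ) + j) (3/4) (by linarith) s2 (by linarith)).trans
    (rpow_neg_anti hj (by linarith) (by norm_num))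
  have b3 := ee_bound' x (3/4) R hx s3 (by norm_num) (by linarith) hn
  have e : x ^ (-(3/4 + 1 : ℝ)) = x ^ (-(30/100 : ℝ)) * x ^ (-(30/100 : ℝ)) * x ^ (-(115/100:ℝ)) := by
    rw [← Real.rpow_add (by linarith), ← Real.rpow_add (by linarith)]; norm_num
  have i1 := rpow_neg_anti (x := (l:ℝ)) (y := x) (a := 30/100) hl (by linarith) (by norm_num)
  have i2 := rpow_neg_anti (x := (j:ℝ)) (y := x) (a := 30/100) hj (by linarith) (by norm_num)
  have i3 := rpow_neg_anti (x := (k:ℝ)) (y := x) (a := 115/100) hk (by linarith) (by norm_num)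
  have b4 : ‖ee x s3‖ ≤ R * ((l:ℝ) ^ (-(30/100 : ℝ)) * (j:ℝ) ^ (-(30/100 : ℝ)) *
      (k:ℝ) ^ (-(115/100:ℝ))) := by
    refine b3.trans ?_
    rw [e]
    gcongr
  have f1 : (l:ℝ) ^ (-(105/100 : ℝ)) = (l:ℝ) ^ (-(3/4 : ℝ)) * (l:ℝ) ^ (-(30/100 : ℝ)) := by
    rw [← Real.rpow_add (by linarith)]; norm_num
  have f2 : (j:ℝ) ^ (-(105/100 : ℝ)) = (j:ℝ) ^ (-(3/4 : ℝ)) * (j:ℝ) ^ (-(30/100 : ℝ)) := by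
    rw [← Real.rpow_add (by linarith)]; norm_num
  simp only [tA, uA, norm_mul, f1, f2]
  refine (mul_le_mul (mul_le_mul b1 b2 (norm_nonneg _) (by positivity)) b4 (norm_nonneg _)
    (by positivity)).trans (le_of_eq (by ring))

lemma tG_bound (R : ℝ) (q : ℕ+ × ℕ+) (p : ℂ × ℂ × ℂ) (hp : p ∈ DD) (hR : ‖p‖ ≤ R) :
    ‖tG q p‖ ≤ (R + R + 1) * uG q := by
  obtain ⟨l, j⟩ := q
  obtain ⟨s1, s2, s3⟩ := p
  obtain ⟨g1, g2, g3⟩ := hp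
  simp only at g1 g2 g3
  have hl := pnat_one_le l
  have hj := pnat_one_le j
  have hR0 : 0 ≤ R := (norm_nonneg _).trans hR
  have hn3 : ‖s3‖ ≤ R := (norm_snd_le (s2, s3)).trans ((norm_snd_le (s1, s2, s3)).trans hR)
  have hn2 : ‖s2‖ ≤ R := (norm_fst_le (s2, s3)).trans ((norm_snd_le (s1, s2, s3)).trans hR)
  have hn : ‖s2 + s3 - 1‖ ≤ R + R + 1 := by
    refine (norm_sub_le _ _).trans ?_
    have := norm_add_le s2 s3
    rw [norm_one]
    linarith
  set x : ℝ := (l:ℝ) + j - 1 with hxd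
  have hx : 1 ≤ x := by linarith
  have b1 := cpow_bound l (3/4) hl s1 (by linarith)
  have b3 := ee_bound' x (1/2) (R + R + 1) hx (s2 + s3 - 1) (by norm_num)
    (by simp only [sub_re, add_re, one_re]; linarith) hn
  have e : x ^ (-(1/2 + 1 : ℝ)) = x ^ (-(30/100 : ℝ)) * x ^ (-(120/100:ℝ)) := by
    rw [← Real.rpow_add (by linarith)]; norm_num
  have i1 := rpow_neg_anti (x := (l:ℝ)) (y := x) (a := 30/100) hl (by linarith) (by norm_num)
  have i2 := rpow_neg_anti (x := (j:ℝ)) (y := x) (a := 120/100) hj (by linarith) (by norm_num)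
  have b4 : ‖ee x (s2 + s3 - 1)‖ ≤ (R + R + 1) * ((l:ℝ) ^ (-(30/100 : ℝ)) *
      (j:ℝ) ^ (-(120/100:ℝ))) := by
    refine b3.trans ?_
    rw [e]
    gcongr
  have f1 : (l:ℝ) ^ (-(105/100 : ℝ)) = (l:ℝ) ^ (-(3/4 : ℝ)) * (l:ℝ) ^ (-(30/100 : ℝ)) := by
    rw [← Real.rpow_add (by linarith)]; norm_num
  simp only [tG, uG, norm_mul, f1]
  refine (mul_le_mul b1 b4 (norm_nonneg _) (by positivity)).trans (le_of_eq (by ring))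

lemma summable_tA (p : ℂ × ℂ × ℂ) (hp : p ∈ DD) : Summable (fun q => tA q p) :=
  Summable.of_norm_bounded (summable_uA.mul_left ‖p‖) fun q => tA_bound _ q p hp le_rfl

lemma summable_tG (p : ℂ × ℂ × ℂ) (hp : p ∈ DD) : Summable (fun q => tG q p) :=
  Summable.of_norm_bounded (summable_uG.mul_left (‖p‖ + ‖p‖ + 1))
    fun q => tG_bound _ q p hp le_rfl

noncomputable def fA (p : ℂ × ℂ × ℂ) : ℂ := ∑' q, tA q p
noncomputable def fG (p : ℂ × ℂ × ℂ) : ℂ := ∑' q, tG q p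

lemma fA_analytic : AnalyticOnNhd ℂ fA DD := by
  intro p hp
  have hm : p ∈ DD ∩ ball 0 (‖p‖ + 1) := ⟨hp, by simp⟩
  refine analytic_tsum3 (isOpen_DD.inter isOpen_ball) (fun q p _ => tA_analytic q p)
    (summable_uA.mul_left (‖p‖ + 1)) (fun q p' hp' => tA_bound _ q p' hp'.1 ?_) p hm
  have := hp'.2
  rw [mem_ball_zero_iff] at this
  exact this.le

lemma fG_analytic : AnalyticOnNhd ℂ fG DD := by
  intro p hp
  have hm : p ∈ DD ∩ ball 0 (‖p‖ + 1) := ⟨hp, by simp⟩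
  refine analytic_tsum3 (isOpen_DD.inter isOpen_ball) (fun q p _ => tG_analytic q p)
    (summable_uG.mul_left ((‖p‖ + 1) + (‖p‖ + 1) + 1)) (fun q p' hp' => tG_bound _ q p' hp'.1 ?_) p hm
  have := hp'.2
  rw [mem_ball_zero_iff] at this
  exact this.le

lemma zeta_pnat (s : ℂ) (hs : 1 < s.re) :
    ∑' l : ℕ+, ((l : ℝ) : ℂ) ^ (-s) = riemannZeta s ∧ Summable (fun l : ℕ+ => ((l : ℝ) : ℂ) ^ (-s)) := by
  constructor
  · rw [zeta_eq_tsum_one_div_nat_add_one_cpow hs, ← Equiv.pnatEquivNat.symm.tsum_eq]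
    refine tsum_congr fun k => ?_
    simp [Complex.cpow_neg]
  · refine Summable.of_norm_bounded (summable_pnat s.re hs) fun l => ?_
    exact cpow_bound _ _ (pnat_one_le l) _ le_rfl

lemma double_sum (s1 s2 s3 : ℂ) (hD : (s1, s2, s3) ∈ DD) (h2 : 2 < (s2 + s3).re)
    (h3 : 3 < (s1 + s2 + s3).re) :
    (∑' q : ℕ+ × ℕ+, ((q.1 : ℝ) : ℂ) ^ (-s1) *
        (((q.1 : ℝ) + (q.2 : ℝ) : ℝ) : ℂ) ^ (-(s2 + s3 - 1)) =
      fG (s1, s2, s3) + riemannZeta (s1 + s2 + s3 - 2) / (s2 + s3 - 2)) ∧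
    Summable (fun q : ℕ+ × ℕ+ => ((q.1 : ℝ) : ℂ) ^ (-s1) *
        (((q.1 : ℝ) + (q.2 : ℝ) : ℝ) : ℂ) ^ (-(s2 + s3 - 1))) := by
  have hS : Summable (fun q : ℕ+ × ℕ+ => ((q.1 : ℝ) : ℂ) ^ (-s1) *
        (((q.1 : ℝ) + (q.2 : ℝ) : ℝ) : ℂ) ^ (-(s2 + s3 - 1))) := by
    simp only [add_re] at h2 h3
    refine Summable.of_norm_bounded (summable2 s1.re (s2 + s3 - 1).re
      (by simp only [sub_re, add_re, one_re]; linarith)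
      (by simp only [sub_re, add_re, one_re]; linarith)) fun q => ?_
    have h1 := pnat_one_le q.1
    have h2 := pnat_one_le q.2
    rw [norm_mul]
    exact mul_le_mul (cpow_bound _ _ h1 _ le_rfl) (cpow_bound _ _ (by linarith) _ le_rfl)
      (norm_nonneg _) (by positivity)
  refine ⟨?_, hS⟩
  have hw : 1 < (s2 + s3 - 1).re := by simp only [sub_re, one_re]; linarith
  obtain ⟨z1, z2⟩ := zeta_pnat (s1 + s2 + s3 - 2) (by
    rw [sub_re]; simp only [re_ofNat]; linarith)
  have SG := summable_tG _ hD
  rw [hS.tsum_prod, fG, SG.tsum_prod, ← z1, ← tsum_div_const,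
    ← (SG.prod).tsum_add (z2.div_const _)]
  refine tsum_congr fun l => ?_
  have hl0 : ((l : ℝ) : ℂ) ≠ 0 := by
    have := pnat_one_le l
    exact_mod_cast (by linarith : (l:ℝ) ≠ 0)
  simp only [tG]
  rw [tsum_mul_left, tsum_mul_left, tail_sum l _ hw, mul_add,
    show -(s1 + s2 + s3 - 2) = -s1 + (1 - (s2 + s3 - 1)) by ring, Complex.cpow_add _ _ hl0]
  ring

theorem main_identity (s1 s2 s3 : ℂ) (hD : (s1, s2, s3) ∈ DD) (h1 : 1 < s3.re)
    (h2 : 2 < (s2 + s3).re) (h3 : 3 < (s1 + s2 + s3).re) :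
    ∑' p : ℕ+ × ℕ+ × ℕ+,
    ((p.1 : ℕ) : ℂ) ^ (-s1) * ((((p.1 : ℕ) + (p.2.1 : ℕ)) : ℂ) ^ (-s2)) *
      ((((p.1 : ℕ) + (p.2.1 : ℕ) + (p.2.2 : ℕ)) : ℂ) ^ (-s3)) = fA (s1, s2, s3) +
      (fG (s1, s2, s3) + riemannZeta (s1 + s2 + s3 - 2) / (s2 + s3 - 2)) / (s3 - 1) := by
  obtain ⟨d1, d2⟩ := double_sum s1 s2 s3 hD h2 h3
  have SA := summable_tA _ hD
  have hS : Summable (fun q : (ℕ+ × ℕ+) × ℕ+ => ((q.1.1 : ℝ) : ℂ) ^ (-s1) *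
      (((q.1.1 : ℝ) + (q.1.2 : ℝ) : ℝ) : ℂ) ^ (-s2) *
      (((q.1.1 : ℝ) + (q.1.2 : ℝ) + (q.2 : ℝ) : ℝ) : ℂ) ^ (-s3)) := by
    simp only [add_re] at h2 h3
    refine Summable.of_norm_bounded (summable3 s1.re s2.re s3.re h1 h2 h3) fun q => ?_
    have h1 := pnat_one_le q.1.1
    have h2 := pnat_one_le q.1.2
    have h3 := pnat_one_le q.2
    rw [norm_mul, norm_mul]
    exact mul_le_mul (mul_le_mul (cpow_bound _ _ h1 _ le_rfl)
      (cpow_bound _ _ (by linarith) _ le_rfl) (norm_nonneg _) (by positivity))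
      (cpow_bound _ _ (by linarith) _ le_rfl) (norm_nonneg _) (by positivity)
  rw [← (Equiv.prodAssoc ℕ+ ℕ+ ℕ+).tsum_eq]
  have : ∀ q : (ℕ+ × ℕ+) × ℕ+, (((Equiv.prodAssoc ℕ+ ℕ+ ℕ+ q).1 : ℕ) : ℂ) ^ (-s1) *
      (((((Equiv.prodAssoc ℕ+ ℕ+ ℕ+ q).1 : ℕ) + ((Equiv.prodAssoc ℕ+ ℕ+ ℕ+ q).2.1 : ℕ)) : ℂ) ^ (-s2)) *
      (((((Equiv.prodAssoc ℕ+ ℕ+ ℕ+ q).1 : ℕ) + ((Equiv.prodAssoc ℕ+ ℕ+ ℕ+ q).2.1 : ℕ) +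
        ((Equiv.prodAssoc ℕ+ ℕ+ ℕ+ q).2.2 : ℕ)) : ℂ) ^ (-s3)) = ((q.1.1 : ℝ) : ℂ) ^ (-s1) *
      (((q.1.1 : ℝ) + (q.1.2 : ℝ) : ℝ) : ℂ) ^ (-s2) *
      (((q.1.1 : ℝ) + (q.1.2 : ℝ) + (q.2 : ℝ) : ℝ) : ℂ) ^ (-s3) := by
    intro q
    simp
  rw [tsum_congr this, hS.tsum_prod, ← d1, fA, SA.tsum_prod, ← tsum_div_const,
    ← (SA.prod).tsum_add (d2.div_const _)]
  refine tsum_congr fun q => ?_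
  obtain ⟨l, j⟩ := q
  have hl := pnat_one_le l
  have hj := pnat_one_le j
  have hl0 : (((l : ℝ) + (j : ℝ) : ℝ) : ℂ) ≠ 0 := by
    exact_mod_cast (by linarith : (l:ℝ) + j ≠ 0)
  simp only [tA]
  have ht := tail_sum (l + j) s3 h1
  simp only [PNat.add_coe, Nat.cast_add] at ht
  rw [tsum_mul_left, tsum_mul_left, ht, mul_add,
    show -(s2 + s3 - 1) = -s2 + (1 - s3) by ring, Complex.cpow_add _ _ hl0]
  ring

theorem main_exists :
    ∃ h₁ : ℂ × ℂ → ℂ, ∃ h₂ : ℂ × ℂ × ℂ → ℂ,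
        AnalyticOnNhd ℂ h₁ {p : ℂ × ℂ | 1 - (1/4 : ℝ) < p.1.re ∧ 1 - (1/4 : ℝ) < p.2.re} ∧
        AnalyticOnNhd ℂ h₂ DD ∧
        ∀ s₁ s₂ s₃ : ℂ, (s₁, s₂, s₃) ∈ DD →
          1 < s₃.re → 2 < (s₂ + s₃).re → 3 < (s₁ + s₂ + s₃).re →
          zeta3 s₁ s₂ s₃ =
            riemannZeta (s₁ + s₂ + s₃ - 2) / ((s₃ - 1) * (s₂ + s₃ - 2)) +
              h₁ (s₁, s₂) / (s₃ - 1) + h₂ (s₁, s₂, s₃) := by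
  refine ⟨fun p => fG (p.1, p.2, 1),
    fun p => dslope (fun z => fG (p.1, p.2.1, z)) 1 p.2.2 + fA p, ?_, ?_, ?_⟩
  · intro p hp
    refine AnalyticAt.fun_comp_of_eq (fG_analytic (p.1, p.2, 1) ⟨hp.1, hp.2, by norm_num⟩)
      (analyticAt_fst.prod (analyticAt_snd.prod analyticAt_const)) rfl
  · refine AnalyticOnNhd.add (analytic_dslope3 isOpen_DD (fun p hp => ⟨hp.1, hp.2.1, by norm_num⟩)
      fG_analytic) fA_analytic
  · intro s1 s2 s3 hD h1 h2 h3
    have hs3 : s3 ≠ 1 := by rintro rfl; simp at h1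
    have hs23 : s2 + s3 - 2 ≠ 0 := by
      intro h
      rw [sub_eq_zero.1 h] at h2
      simp at h2
    have hs3' := sub_ne_zero.2 hs3
    rw [zeta3, main_identity s1 s2 s3 hD h1 h2 h3]
    simp only
    rw [dslope_of_ne _ hs3, slope_def_field]
    field_simp
    ring

end Helpers

/-- There exist `δ ∈ (0,1)` and functions `h₁`, analytic on
`{(s₁,s₂) : Re s₁ > 1-δ, Re s₂ > 1-δ}`, and `h₂`, analytic on
`{(s₁,s₂,s₃) : Re sᵢ > 1-δ}`, such that
`ζ₃(s₁,s₂,s₃) = ζ(s₁+s₂+s₃-2)/((s₃-1)(s₂+s₃-2)) + h₁(s₁,s₂)/(s₃-1) + h₂(s₁,s₂,s₃)`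
whenever `Re sᵢ > 1-δ` for all `i`, `Re s₃ > 1`, `Re(s₂+s₃) > 2` and `Re(s₁+s₂+s₃) > 3`. -/
theorem statement11 :
    ∃ δ : ℝ, 0 < δ ∧ δ < 1 ∧
      ∃ h₁ : ℂ × ℂ → ℂ, ∃ h₂ : ℂ × ℂ × ℂ → ℂ,
        AnalyticOnNhd ℂ h₁ {p : ℂ × ℂ | 1 - δ < p.1.re ∧ 1 - δ < p.2.re} ∧
        AnalyticOnNhd ℂ h₂
          {p : ℂ × ℂ × ℂ | 1 - δ < p.1.re ∧ 1 - δ < p.2.1.re ∧ 1 - δ < p.2.2.re} ∧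
        ∀ s₁ s₂ s₃ : ℂ, 1 - δ < s₁.re → 1 - δ < s₂.re → 1 - δ < s₃.re →
          1 < s₃.re → 2 < (s₂ + s₃).re → 3 < (s₁ + s₂ + s₃).re →
          zeta3 s₁ s₂ s₃ =
            riemannZeta (s₁ + s₂ + s₃ - 2) / ((s₃ - 1) * (s₂ + s₃ - 2)) +
              h₁ (s₁, s₂) / (s₃ - 1) + h₂ (s₁, s₂, s₃) := by
  obtain ⟨h₁, h₂, a, b, c⟩ := main_exists
  exact ⟨1/4, by norm_num, by norm_num, h₁, h₂, a, b,
    fun s₁ s₂ s₃ g1 g2 g3 => c s₁ s₂ s₃ ⟨g1, g2, g3⟩⟩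
end

section
/- For every s₁ ∈ ℂ with Re s₁ > 1, the limit as t → 1⁺ (t real, t > 1) of ( ζ₂(s₁, t) − ζ(s₁)/(t−1) ) exists and equals γ ζ(s₁) − ζ₂(1, s₁) − ζ(s₁+1), where γ is the Euler–Mascheroni constant. -/
open Filter Topology

/-- The Euler–Zagier double zeta-function `ζ₂(s₁,s₂) = ∑_{0 < m < n} m^{-s₁} n^{-s₂}`. -/
noncomputable def zeta2 (s₁ s₂ : ℂ) : ℂ :=
  ∑' p : ℕ+ × ℕ+, ((p.1 : ℕ) : ℂ) ^ (-s₁) * ((((p.1 : ℕ) + (p.2 : ℕ)) : ℂ) ^ (-s₂))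

lemma aux_zeta (s : ℂ) (hs : 1 < s.re) :
    riemannZeta s = ∑' n : ℕ+, ((n : ℕ) : ℂ) ^ (-s) := by
  rw [zeta_eq_tsum_one_div_nat_add_one_cpow hs,
    tsum_pnat_eq_tsum_succ (f := fun n : ℕ => (n : ℂ) ^ (-s))]
  refine tsum_congr fun n => ?_
  rw [Complex.cpow_neg]
  push_cast
  simp

lemma aux_norm (n : ℕ+) (s : ℂ) : ‖((n : ℕ) : ℂ) ^ (-s)‖ = ((n : ℕ) : ℝ) ^ (-s.re) := by
  rw [Complex.norm_natCast_cpow_of_pos n.pos, Complex.neg_re]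

lemma aux_rsum (r : ℝ) (hr : 1 < r) : Summable fun n : ℕ+ => ((n : ℕ) : ℝ) ^ (-r) :=
  (Real.summable_nat_rpow.mpr (by linarith : -r < -1)).comp_injective PNat.coe_injective

lemma aux_csum (s : ℂ) (hs : 1 < s.re) : Summable fun n : ℕ+ => ‖((n : ℕ) : ℂ) ^ (-s)‖ := by
  simp_rw [aux_norm]
  exact aux_rsum _ hs

def auxMap : (ℕ+ × ℕ+) ⊕ ((ℕ+ × ℕ+) ⊕ ℕ+) → ℕ+ × ℕ+
  | .inl p => (p.1, p.1 + p.2)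
  | .inr (.inl p) => (p.1 + p.2, p.1)
  | .inr (.inr n) => (n, n)

lemma auxMap_bij : Function.Bijective auxMap := by
  constructor
  · rintro (⟨a, b⟩ | ⟨a, b⟩ | a) (⟨c, d⟩ | ⟨c, d⟩ | c) h <;>
    · simp only [auxMap, Prod.mk.injEq, ← PNat.coe_inj, PNat.add_coe, Sum.inl.injEq,
        Sum.inr.injEq] at h ⊢
      have := a.pos
      have := c.pos
      try have := b.pos
      try have := d.pos
      try simp only [reduceCtorEq]
      omega
  · rintro ⟨a, b⟩
    rcases lt_trichotomy a b with h | h | h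
    · exact ⟨.inl (a, b - a), by simp [auxMap, PNat.add_sub_of_lt h]⟩
    · exact ⟨.inr (.inr a), by simp [auxMap, h]⟩
    · exact ⟨.inr (.inl (b, a - b)), by simp [auxMap, PNat.add_sub_of_lt h]⟩

lemma aux_harm (s t : ℂ) (hs : 1 < s.re) (ht : 1 < t.re) :
    riemannZeta s * riemannZeta t = zeta2 s t + (zeta2 t s + riemannZeta (s + t)) := by
  have hst : 1 < (s + t).re := by rw [Complex.add_re]; linarith
  rw [aux_zeta s hs, aux_zeta t ht, aux_zeta _ hst]
  rw [tsum_mul_tsum_of_summable_norm (aux_csum s hs) (aux_csum t ht)]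
  have hS := summable_mul_of_summable_norm (aux_csum s hs) (aux_csum t ht)
  rw [← (Equiv.ofBijective _ auxMap_bij).tsum_eq]
  rw [← (Equiv.ofBijective _ auxMap_bij).summable_iff] at hS
  have h1 := hS.comp_injective Sum.inl_injective
  have h2 := hS.comp_injective Sum.inr_injective
  have h3 := h2.comp_injective Sum.inl_injective
  have h4 := h2.comp_injective Sum.inr_injective
  have key := h1.hasSum.sum (h3.hasSum.sum h4.hasSum)
  refine key.tsum_eq.trans ?_
  congr 1
  · refine tsum_congr fun p => ?_
    simp [auxMap]
  congr 1
  · refine tsum_congr fun p => ?_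
    simp [auxMap, mul_comm]
  · refine tsum_congr fun n => ?_
    simp only [Function.comp_apply, Equiv.ofBijective_apply, auxMap]
    rw [neg_add, Complex.cpow_add _ _ (by exact_mod_cast n.ne_zero)]

lemma aux_lim (s : ℂ) (hs : 1 < s.re) :
    Tendsto (fun t : ℝ => zeta2 (t : ℂ) s) (nhdsWithin 1 (Set.Ioi 1)) (nhds (zeta2 1 s)) := by
  unfold zeta2
  obtain ⟨δ, hδ, hd⟩ : ∃ δ : ℝ, 0 < δ ∧ s.re = 1 + 2 * δ := ⟨(s.re - 1) / 2, by linarith, by ring⟩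
  have hb : Summable fun p : ℕ+ × ℕ+ =>
      ((p.1 : ℕ) : ℝ) ^ (-(1 + δ)) * ((p.2 : ℕ) : ℝ) ^ (-(1 + δ)) :=
    (aux_rsum _ (by linarith)).mul_of_nonneg (aux_rsum _ (by linarith))
      (fun _ => by positivity) (fun _ => by positivity)
  refine tendsto_tsum_of_dominated_convergence hb ?_ ?_
  · rintro ⟨m, n⟩
    refine Tendsto.mul_const _ ?_
    have hm : ((m : ℕ) : ℂ) ≠ 0 := by exact_mod_cast m.ne_zero
    have hc : Continuous fun t : ℝ => ((m : ℕ) : ℂ) ^ (-(t : ℂ)) :=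
      Continuous.const_cpow (by fun_prop) (Or.inl hm)
    have := hc.tendsto 1
    simp only [Complex.ofReal_one] at this
    exact this.mono_left nhdsWithin_le_nhds
  · filter_upwards [self_mem_nhdsWithin] with t ht
    rintro ⟨m, n⟩
    have hm : (1 : ℝ) ≤ ((m : ℕ) : ℝ) := by exact_mod_cast m.pos
    have hn : (1 : ℝ) ≤ ((n : ℕ) : ℝ) := by exact_mod_cast n.pos
    have e := aux_norm (m + n) s
    simp only [PNat.add_coe, Nat.cast_add] at e
    rw [norm_mul, aux_norm, e, Complex.ofReal_re, hd]
    have ht' : (1 : ℝ) < t := ht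
    have hm0 : (0 : ℝ) < ((m : ℕ) : ℝ) := by linarith
    have hn0 : (0 : ℝ) < ((n : ℕ) : ℝ) := by linarith
    have a1 : ((m : ℕ) : ℝ) ^ (-t) ≤ ((m : ℕ) : ℝ) ^ (-1 : ℝ) :=
      Real.rpow_le_rpow_of_exponent_le hm (by linarith)
    have a2 : (((m : ℕ) : ℝ) + ((n : ℕ) : ℝ)) ^ (-(1 + 2 * δ)) ≤
        ((m : ℕ) : ℝ) ^ (-δ) * ((n : ℕ) : ℝ) ^ (-(1 + δ)) := by
      rw [show -(1 + 2 * δ) = -δ + -(1 + δ) by ring, Real.rpow_add (by linarith)]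
      exact mul_le_mul
        (Real.rpow_le_rpow_of_nonpos hm0 (by linarith) (by linarith))
        (Real.rpow_le_rpow_of_nonpos hn0 (by linarith) (by linarith))
        (by positivity) (by positivity)
    calc _ ≤ ((m : ℕ) : ℝ) ^ (-1 : ℝ) *
          (((m : ℕ) : ℝ) ^ (-δ) * ((n : ℕ) : ℝ) ^ (-(1 + δ))) :=
          mul_le_mul a1 a2 (by positivity) (by positivity)
      _ = _ := by
          rw [← mul_assoc, ← Real.rpow_add hm0]
          congr 2
          ring

/-- For `Re s₁ > 1`, the double Euler constant:
`ζ₂(s₁,t) - ζ(s₁)/(t-1) → γ ζ(s₁) - ζ₂(1,s₁) - ζ(s₁+1)` as `t → 1⁺`. -/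
theorem statement14 (s₁ : ℂ) (h₁ : 1 < s₁.re) :
    Tendsto (fun t : ℝ => zeta2 s₁ (t : ℂ) - riemannZeta s₁ / ((t : ℂ) - 1))
      (nhdsWithin 1 (Set.Ioi 1))
      (nhds ((Real.eulerMascheroniConstant : ℂ) * riemannZeta s₁ - zeta2 1 s₁ -
        riemannZeta (s₁ + 1))) := by
  have hne : s₁ + 1 ≠ 1 := by
    intro h
    have : s₁ = 0 := by simpa using h
    rw [this, Complex.zero_re] at h₁
    linarith
  have c1 : Tendsto (fun t : ℝ => riemannZeta (s₁ + (t : ℂ))) (nhdsWithin 1 (Set.Ioi 1))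
      (nhds (riemannZeta (s₁ + 1))) := by
    refine (differentiableAt_riemannZeta hne).continuousAt.tendsto.comp ?_
    have hc : Continuous fun t : ℝ => s₁ + (t : ℂ) := by fun_prop
    have := hc.tendsto 1
    simp only [Complex.ofReal_one] at this
    exact this.mono_left nhdsWithin_le_nhds
  have c2 := ZetaAsymptotics.tendsto_riemannZeta_sub_one_div_nhds_right
  have c3 := ((c2.mul_const (riemannZeta s₁)).sub (aux_lim s₁ h₁)).sub c1
  refine c3.congr' ?_
  filter_upwards [self_mem_nhdsWithin] with t ht
  have := aux_harm s₁ t h₁ (by simpa using ht)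
  have e : zeta2 s₁ t = riemannZeta s₁ * riemannZeta t - zeta2 t s₁ - riemannZeta (s₁ + t) := by
    rw [this]; ring
  rw [e]
  ring
end
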